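/- If S is a finite set with |S| = s ≥ 1 and 𝒜 is a system on S with |𝒜| ≥ 2^(s-1) + 1, then 𝒜 is a non-Bondy system. -/

import Mathlib

def IsBondy {α : Type*} [DecidableEq α] (S : Finset α) (𝒜 : Finset (Finset α)) : Prop :=
  ∃ a ∈ S, ∀ A ∈ 𝒜, insert a A ∈ 𝒜 → a ∈ A

theorem nonBondy_of_large {α : Type*} [DecidableEq α] (S : Finset α)
    (𝒜 : Finset (Finset α)) (hs : 1 ≤ S.card) (hsub : ∀ A ∈ 𝒜, A ⊆ S)
    (hcard : 2 ^ (S.card - 1) + 1 ≤ 𝒜.card) :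
    ¬ IsBondy S 𝒜 := by
  rintro ⟨a, ha, h⟩
  have hinj : Set.InjOn (fun A : Finset α => A.erase a) 𝒜 := by
    intro A hA B hB hAB
    have hAB : A.erase a = B.erase a := hAB
    by_cases haA : a ∈ A <;> by_cases haB : a ∈ B
    · rw [← Finset.insert_erase haA, hAB, Finset.insert_erase haB]
    · rw [Finset.erase_eq_of_notMem haB] at hAB
      exact absurd (h B hB (by rw [← hAB, Finset.insert_erase haA]; exact hA)) haB
    · rw [Finset.erase_eq_of_notMem haA] at hAB
      exact absurd (h A hA (by rw [hAB, Finset.insert_erase haB]; exact hB)) haA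
    · rwa [Finset.erase_eq_of_notMem haA, Finset.erase_eq_of_notMem haB] at hAB
  have hle : 𝒜.card ≤ (S.erase a).powerset.card :=
    Finset.card_le_card_of_injOn _
      (fun A hA => Finset.mem_powerset.2 (Finset.erase_subset_erase a (hsub A hA))) hinj
  rw [Finset.card_powerset, Finset.card_erase_of_mem ha] at hle
  omega
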